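/- arXiv:1810.03553 — 2 statements merged into one kernel-verified Lean document; each statement's English description precedes it below -/
import Mathlib

section
/- Suppose S is a strongly continuous semigroup on H generated by 𝒜₀, and suppose the ISS and existence hypotheses hold. Then for every X₀ ∈ H and all continuous d : [0,∞) → ℂ^m and U : [0,∞) → H, there exists a unique weak solution X associated with (X₀, d, U); moreover X satisfies, for all t ≥ 0, ‖X(t)‖ ≤ β(‖X₀‖, t) + γ₁(sup_{0≤s≤t} ‖d(s)‖) + γ₂(sup_{0≤s≤t} ‖U(s)‖). -/
noncomputable section

local notation "⟪" x ", " y "⟫" => @inner ℂ _ _ x y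

/-- `f` is linear on the subset `s`. -/
def IsLinearOn {H K : Type*} [AddCommGroup H] [Module ℂ H] [AddCommGroup K] [Module ℂ K]
    (f : H → K) (s : Set H) : Prop :=
  (∀ x ∈ s, ∀ y ∈ s, f (x + y) = f x + f y) ∧ ∀ (c : ℂ), ∀ x ∈ s, f (c • x) = c • f x

/-- `X` is a classical solution of the boundary control system `(A, Bop)` with domain `domA`,
associated with initial condition `X0`, boundary disturbance `d` and distributed
disturbance `U`. -/
def IsClassicalSolution {H : Type*} [NormedAddCommGroup H] [NormedSpace ℂ H] {m : ℕ}
    (A : H → H) (Bop : H → EuclideanSpace ℂ (Fin m)) (domA : Set H)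
    (X0 : H) (d : ℝ → EuclideanSpace ℂ (Fin m)) (U : ℝ → H) (X : ℝ → H) : Prop :=
  ContinuousOn X (Set.Ici 0) ∧
  (∀ t ∈ Set.Ici (0:ℝ), X t ∈ domA) ∧
  ContinuousOn (fun t => A (X t)) (Set.Ici 0) ∧
  (∀ t ∈ Set.Ici (0:ℝ), HasDerivWithinAt X (A (X t) + U t) (Set.Ici 0) t) ∧
  X 0 = X0 ∧
  ∀ t ∈ Set.Ici (0:ℝ), Bop (X t) = d t

/-- `X` is a weak solution of the boundary control system, associated with `(X0, d, U)`:
for every `T > 0` and every test function `z` over `[0, T]` (continuously differentiable,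
valued in the domain `domAstar` of the adjoint `Astar` of the disturbance-free operator,
with `Astar ∘ z` continuous and `z T = 0`) the variational identity holds. -/
def IsWeakSolution {H : Type*} [NormedAddCommGroup H] [InnerProductSpace ℂ H] {m : ℕ}
    (A : H → H) (domAstar : Set H) (Astar : H → H)
    (B : EuclideanSpace ℂ (Fin m) →L[ℂ] H)
    (X0 : H) (d : ℝ → EuclideanSpace ℂ (Fin m)) (U : ℝ → H) (X : ℝ → H) : Prop :=
  ContinuousOn X (Set.Ici 0) ∧
  ∀ T > (0:ℝ), ∀ z z' : ℝ → H,
    (∀ t ∈ Set.Icc (0:ℝ) T, z t ∈ domAstar) →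
    (∀ t ∈ Set.Icc (0:ℝ) T, HasDerivWithinAt z (z' t) (Set.Icc 0 T) t) →
    ContinuousOn z' (Set.Icc 0 T) →
    ContinuousOn (fun t => Astar (z t)) (Set.Icc 0 T) →
    z T = 0 →
    (∫ t in (0:ℝ)..T, ⟪Astar (z t) + z' t, X t⟫) =
      -⟪z 0, X0⟫ + (∫ t in (0:ℝ)..T, ⟪Astar (z t), B (d t)⟫)
        - (∫ t in (0:ℝ)..T, ⟪z t, A (B (d t))⟫)
        - ∫ t in (0:ℝ)..T, ⟪z t, U t⟫

/-- `S` is a strongly continuous semigroup on `H` whose generator is the restriction of `A`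
to `domA0`. -/
def IsC0SemigroupGeneratedBy {H : Type*} [NormedAddCommGroup H] [NormedSpace ℂ H]
    (S : ℝ → H →L[ℂ] H) (domA0 : Set H) (A : H → H) : Prop :=
  S 0 = ContinuousLinearMap.id ℂ H ∧
  (∀ t ∈ Set.Ici (0:ℝ), ∀ s ∈ Set.Ici (0:ℝ), S (t + s) = (S t).comp (S s)) ∧
  (∀ x : H, ContinuousOn (fun t => S t x) (Set.Ici 0)) ∧
  (∀ x : H, x ∈ domA0 ↔ ∃ y : H,
      Filter.Tendsto (fun h : ℝ => h⁻¹ • (S h x - x)) (nhdsWithin 0 (Set.Ioi 0)) (nhds y)) ∧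
  ∀ x ∈ domA0, Filter.Tendsto (fun h : ℝ => h⁻¹ • (S h x - x)) (nhdsWithin 0 (Set.Ioi 0)) (nhds (A x))

/-- Comparison functions of class `𝒦`. -/
def ClassK (γ : ℝ → ℝ) : Prop :=
  ContinuousOn γ (Set.Ici 0) ∧ StrictMonoOn γ (Set.Ici 0) ∧ γ 0 = 0 ∧
    ∀ x ∈ Set.Ici (0:ℝ), 0 ≤ γ x

/-- Comparison functions of class `𝒦ℒ`. -/
def ClassKL (β : ℝ → ℝ → ℝ) : Prop :=
  ContinuousOn (fun p : ℝ × ℝ => β p.1 p.2) (Set.Ici 0 ×ˢ Set.Ici 0) ∧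
  (∀ t ∈ Set.Ici (0:ℝ), ClassK fun x => β x t) ∧
  ∀ x > (0:ℝ), StrictAntiOn (β x) (Set.Ici 0) ∧
    Filter.Tendsto (β x) Filter.atTop (nhds 0)

section helpers
open Set Filter Topology MeasureTheory

variable {H : Type*} [NormedAddCommGroup H] [InnerProductSpace ℂ H] [CompleteSpace H]

lemma aux_cont_max {E : Type*} [TopologicalSpace E] {f : ℝ → E} (hf : ContinuousOn f (Ici 0)) :
    Continuous (fun s => f (max s 0)) := by
  refine hf.comp_continuous (by fun_prop) (fun s => ?_)
  simp

lemma sg_integral (S : ℝ → H →L[ℂ] H) (D : Set H) (A : H → H)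
    (hS : IsC0SemigroupGeneratedBy S D A) (x : H) (hx : x ∈ D) (t : ℝ) (ht : 0 ≤ t) :
    S t x - x = ∫ s in (0:ℝ)..t, S (max s 0) (A x) := by
  obtain ⟨h0, hadd, hcont, -, hgen⟩ := hS
  have hg : Continuous (fun s => S (max s 0) (A x)) := aux_cont_max (hcont (A x))
  have hint : ∀ s, HasDerivAt (fun u => ∫ r in (0:ℝ)..u, S (max r 0) (A x)) (S (max s 0) (A x)) s :=
    fun s => intervalIntegral.integral_hasDerivAt_right (hg.intervalIntegrable _ _)
      hg.stronglyMeasurable.stronglyMeasurableAtFilter hg.continuousAt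
  have key := constant_of_has_deriv_right_zero (a := 0) (b := t)
    (f := fun u => S u x - ∫ r in (0:ℝ)..u, S (max r 0) (A x)) ?_ ?_ t ⟨ht, le_rfl⟩
  · simp only [intervalIntegral.integral_same, h0, ContinuousLinearMap.id_apply, sub_zero] at key
    rw [sub_eq_iff_eq_add] at key ⊢
    rw [key, add_comm]
  · refine ((hcont x).mono Icc_subset_Ici_self).sub ?_
    exact fun s _ => (hint s).continuousAt.continuousWithinAt
  · intro s hs
    have h1 : HasDerivWithinAt (fun u => S u x) (S s (A x)) (Ici s) s := by
      rw [← hasDerivWithinAt_Ioi_iff_Ici, hasDerivWithinAt_iff_tendsto_slope' (by simp)]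
      have hm : Tendsto (fun y => y - s) (𝓝[>] s) (𝓝[>] 0) := by
        refine tendsto_nhdsWithin_iff.2 ⟨?_, ?_⟩
        · have : Tendsto (fun y => y - s) (𝓝 s) (𝓝 (s - s)) := 
            (continuous_id.sub continuous_const).tendsto s
          rw [sub_self] at this
          exact this.mono_left nhdsWithin_le_nhds
        · filter_upwards [self_mem_nhdsWithin] with y hy
          simpa using hy
      have h2 := ((S s).continuous.tendsto (A x)).comp ((hgen x hx).comp hm)
      refine h2.congr' ?_
      filter_upwards [self_mem_nhdsWithin] with y hy
      have hy' : s < y := hy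
      have : S y = (S s).comp (S (y - s)) := by
        rw [← hadd s hs.1 (y - s) (by simp; exact hy'.le)]; congr 1; ring
      simp only [Function.comp, slope, vsub_eq_sub, this]
      rw [← Complex.coe_smul, ← Complex.coe_smul, map_smul, map_sub, ContinuousLinearMap.comp_apply]
    have h3 := h1.sub (hint s).hasDerivWithinAt
    rwa [max_eq_left hs.1, sub_self] at h3

lemma sg_closed (S : ℝ → H →L[ℂ] H) (D : Set H) (A : H → H)
    (hS : IsC0SemigroupGeneratedBy S D A) (u : ℕ → H) (hu : ∀ n, u n ∈ D) (x y : H)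
    (hx : Tendsto u atTop (𝓝 x)) (hy : Tendsto (fun n => A (u n)) atTop (𝓝 y)) :
    x ∈ D ∧ A x = y := by
  have hint := sg_integral S D A hS
  obtain ⟨h0, hadd, hcont, hD, hgen⟩ := hS
  have hg : ∀ z, Continuous (fun s => S (max s 0) z) := fun z => aux_cont_max (hcont z)
  have key : ∀ t, 0 ≤ t → S t x - x = ∫ s in (0:ℝ)..t, S (max s 0) y := by
    intro t ht
    obtain ⟨M, hM⟩ := banach_steinhaus (g := fun i : Icc (0:ℝ) t => S i) (fun z => by
      obtain ⟨C, hC⟩ := isCompact_Icc.exists_bound_of_continuousOn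
        ((hcont z).mono (Icc_subset_Ici_self : Icc 0 t ⊆ Ici 0))
      exact ⟨C, fun i => hC i i.2⟩)
    have l1 : Tendsto (fun n => S t (u n) - u n) atTop (𝓝 (S t x - x)) :=
      (((S t).continuous.tendsto x).comp hx).sub hx
    have l2 : Tendsto (fun n => ∫ s in (0:ℝ)..t, S (max s 0) (A (u n))) atTop
        (𝓝 (∫ s in (0:ℝ)..t, S (max s 0) y)) := by
      rw [tendsto_iff_norm_sub_tendsto_zero]
      have b0 : Tendsto (fun n => (M * ‖A (u n) - y‖) * |t - 0|) atTop (𝓝 0) := by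
        have := ((tendsto_iff_norm_sub_tendsto_zero.1 hy).const_mul M).mul_const |t - 0|
        simpa using this
      refine squeeze_zero (fun _ => norm_nonneg _) (fun n => ?_) b0
      rw [← intervalIntegral.integral_sub ((hg _).intervalIntegrable _ _)
        ((hg _).intervalIntegrable _ _)]
      refine intervalIntegral.norm_integral_le_of_norm_le_const (fun s hs => ?_)
      rw [uIoc_of_le ht] at hs
      rw [← map_sub, max_eq_left hs.1.le]
      refine ((S s).le_opNorm _).trans ?_
      gcongr
      exact hM ⟨s, hs.1.le, hs.2⟩
    refine tendsto_nhds_unique l1 (l2.congr fun n => ?_)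
    exact (hint (u n) (hu n) t ht).symm
  have hlim : Tendsto (fun h : ℝ => h⁻¹ • (S h x - x)) (𝓝[>] 0) (𝓝 y) := by
    have hd : HasDerivAt (fun u => ∫ r in (0:ℝ)..u, S (max r 0) y) (S (max 0 0) y) 0 :=
      intervalIntegral.integral_hasDerivAt_right ((hg y).intervalIntegrable _ _)
        (hg y).stronglyMeasurable.stronglyMeasurableAtFilter (hg y).continuousAt
    have h1 := hd.hasDerivWithinAt (s := Ioi 0)
    rw [hasDerivWithinAt_iff_tendsto_slope' (by simp)] at h1
    simp only [max_self, h0, ContinuousLinearMap.id_apply] at h1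
    refine h1.congr' ?_
    filter_upwards [self_mem_nhdsWithin] with h hh
    have hh' : 0 < h := hh
    simp [slope, key h hh'.le]
  have hxD : x ∈ D := (hD x).2 ⟨y, hlim⟩
  exact ⟨hxD, tendsto_nhds_unique (hgen x hxD) hlim⟩

/-- closed densely defined: the biadjoint is the operator itself -/
lemma biadj (D : Submodule ℂ H) (A : H → H)
    (hadd : ∀ x ∈ D, ∀ y ∈ D, A (x + y) = A x + A y)
    (hsmul : ∀ (c : ℂ), ∀ x ∈ D, A (c • x) = c • A x)
    (hclosed : ∀ (u : ℕ → H), (∀ n, u n ∈ D) → ∀ x y, Tendsto u atTop (𝓝 x) →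
      Tendsto (fun n => A (u n)) atTop (𝓝 y) → x ∈ D ∧ A x = y)
    (x y : H) (hxy : ∀ z w : H, (∀ x' ∈ D, ⟪w, x'⟫ = ⟪z, A x'⟫) → ⟪z, y⟫ = ⟪w, x⟫) :
    x ∈ D ∧ A x = y := by
  let G : Submodule ℂ (WithLp 2 (H × H)) :=
    { carrier := {p | p.fst ∈ D ∧ A p.fst = p.snd}
      add_mem' := by
        rintro a b ⟨ha, ha'⟩ ⟨hb, hb'⟩
        refine ⟨by simpa using D.add_mem ha hb, ?_⟩
        simp [hadd _ ha _ hb, ha', hb']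
      zero_mem' := by
        refine ⟨by simp, ?_⟩
        have := hsmul 0 0 D.zero_mem
        simpa using this
      smul_mem' := by
        rintro c a ⟨ha, ha'⟩
        refine ⟨by simpa using D.smul_mem c ha, ?_⟩
        simp [hsmul c _ ha, ha'] }
  have hG : IsClosed (G : Set (WithLp 2 (H × H))) := by
    refine IsSeqClosed.isClosed ?_
    have hfst : Continuous (fun p : WithLp 2 (H × H) => p.fst) :=
      continuous_fst.comp (WithLp.prod_continuous_ofLp 2 H H)
    have hsnd : Continuous (fun p : WithLp 2 (H × H) => p.snd) :=
      continuous_snd.comp (WithLp.prod_continuous_ofLp 2 H H)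
    intro v p hv hp
    exact hclosed (fun n => (v n).fst) (fun n => (hv n).1) p.fst p.snd
      ((hfst.tendsto p).comp hp)
      (((hsnd.tendsto p).comp hp).congr (fun n => ((hv n).2).symm))
  have : WithLp.toLp 2 (x, y) ∈ Gᗮᗮ := by
    rw [Submodule.mem_orthogonal]
    intro q hq
    rw [Submodule.mem_orthogonal'] at hq
    have h1 := hxy q.snd (-q.fst) (fun x' hx' => by
      have := hq (WithLp.toLp 2 (x', A x')) ⟨hx', rfl⟩
      rw [WithLp.prod_inner_apply] at this
      change ⟪q.fst, x'⟫ + ⟪q.snd, A x'⟫ = 0 at this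
      rw [inner_neg_left]
      linear_combination -this)
    rw [WithLp.prod_inner_apply]
    change ⟪q.fst, x⟫ + ⟪q.snd, y⟫ = 0
    rw [h1, inner_neg_left]
    ring
  rw [Submodule.orthogonal_orthogonal_eq_closure, hG.submodule_topologicalClosure_eq] at this
  exact this

lemma dom_sub {K : Type*} [AddCommGroup K] [Module ℂ K] {domA : Set H} {f : H → K}
    (hdomA : ∀ x ∈ domA, ∀ y ∈ domA, ∀ a b : ℂ, a • x + b • y ∈ domA)
    (hf : IsLinearOn f domA) {x y : H} (hx : x ∈ domA) (hy : y ∈ domA) :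
    x - y ∈ domA ∧ f (x - y) = f x - f y := by
  have h0 := hdomA x hx y hy 1 (-1)
  have h1 := hdomA y hy y hy (-1) 0
  simp only [one_smul, neg_smul, ← sub_eq_add_neg, zero_smul, add_zero] at h0 h1
  refine ⟨h0, ?_⟩
  have h2 := hf.1 x hx (-y) h1
  have h3 := hf.2 (-1) y hy
  simp only [one_smul, neg_smul] at h3
  rw [sub_eq_add_neg, h2, h3, sub_eq_add_neg]

lemma classical_sub {m : ℕ} {domA : Set H} {A : H → H} {Bop : H → EuclideanSpace ℂ (Fin m)}
    (hdomA : ∀ x ∈ domA, ∀ y ∈ domA, ∀ a b : ℂ, a • x + b • y ∈ domA)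
    (hAlin : IsLinearOn A domA) (hBoplin : IsLinearOn Bop domA)
    {x1 x2 : H} {d1 d2 : ℝ → EuclideanSpace ℂ (Fin m)} {U1 U2 X1 X2 : ℝ → H}
    (h1 : IsClassicalSolution A Bop domA x1 d1 U1 X1)
    (h2 : IsClassicalSolution A Bop domA x2 d2 U2 X2) :
    IsClassicalSolution A Bop domA (x1 - x2) (fun t => d1 t - d2 t) (fun t => U1 t - U2 t)
      (fun t => X1 t - X2 t) := by
  obtain ⟨a1, a2, a3, a4, a5, a6⟩ := h1
  obtain ⟨b1, b2, b3, b4, b5, b6⟩ := h2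
  have hs : ∀ t ∈ Ici (0:ℝ), A (X1 t - X2 t) = A (X1 t) - A (X2 t) := fun t ht =>
    (dom_sub hdomA hAlin (a2 t ht) (b2 t ht)).2
  refine ⟨a1.sub b1, fun t ht => (dom_sub hdomA hAlin (a2 t ht) (b2 t ht)).1,
    (a3.sub b3).congr hs, fun t ht => ?_, by simp [a5, b5], fun t ht => ?_⟩
  · have := (a4 t ht).sub (b4 t ht)
    refine HasDerivWithinAt.congr_deriv this ?_
    rw [hs t ht]
    exact add_sub_add_comm _ _ _ _
  · rw [(dom_sub hdomA hBoplin (a2 t ht) (b2 t ht)).2, a6 t ht, b6 t ht]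

lemma classical_weak {m : ℕ} {domA : Set H} {A : H → H} {Bop : H → EuclideanSpace ℂ (Fin m)}
    (hdomA : ∀ x ∈ domA, ∀ y ∈ domA, ∀ a b : ℂ, a • x + b • y ∈ domA)
    (hAlin : IsLinearOn A domA) (hBoplin : IsLinearOn Bop domA)
    {domAstar : Set H} {Astar : H → H}
    (hadj : ∀ z ∈ domAstar, ∀ x ∈ domA, Bop x = 0 → ⟪Astar z, x⟫ = ⟪z, A x⟫)
    {B : EuclideanSpace ℂ (Fin m) →L[ℂ] H}
    (hBdom : ∀ v, B v ∈ domA) (hBlift : ∀ v, Bop (B v) = v)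
    (hABcont : Continuous fun v => A (B v))
    {x0 : H} {d : ℝ → EuclideanSpace ℂ (Fin m)} {U X : ℝ → H}
    (hd : ContinuousOn d (Ici 0)) (hU : ContinuousOn U (Ici 0))
    (h : IsClassicalSolution A Bop domA x0 d U X) :
    IsWeakSolution A domAstar Astar B x0 d U X := by
  obtain ⟨a1, a2, a3, a4, a5, a6⟩ := h
  refine ⟨a1, fun T hT z z' hz hzd hz' hAz hzT => ?_⟩
  have hsub : Icc 0 T ⊆ Ici (0:ℝ) := Icc_subset_Ici_self
  have hzc : ContinuousOn z (Icc 0 T) := fun t ht => (hzd t ht).continuousWithinAt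
  have hBd : ContinuousOn (fun t => B (d t)) (Icc 0 T) :=
    B.continuous.comp_continuousOn (hd.mono hsub)
  have hABd : ContinuousOn (fun t => A (B (d t))) (Icc 0 T) :=
    hABcont.comp_continuousOn (hd.mono hsub)
  have ii : ∀ {f : ℝ → ℂ}, ContinuousOn f (Icc 0 T) → IntervalIntegrable f volume 0 T := by
    intro f hf
    apply ContinuousOn.intervalIntegrable
    rwa [uIcc_of_le hT.le]
  have i1 : IntervalIntegrable (fun t => ⟪Astar (z t) + z' t, X t⟫) volume 0 T := ii ((hAz.add hz').inner (𝕜 := ℂ) (a1.mono hsub))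
  have i2 := ii (hAz.inner (𝕜 := ℂ) hBd)
  have i3 := ii (hzc.inner (𝕜 := ℂ) hABd)
  have i4 := ii (hzc.inner (𝕜 := ℂ) (hU.mono hsub))
  have hder : ∀ t ∈ Icc 0 T, HasDerivWithinAt (fun t => ⟪z t, X t⟫)
      (⟪Astar (z t) + z' t, X t⟫ - ⟪Astar (z t), B (d t)⟫ + ⟪z t, A (B (d t))⟫ + ⟪z t, U t⟫)
      (Icc 0 T) t := by
    intro t ht
    have h1 := (hzd t ht).inner (𝕜 := ℂ) ((a4 t (hsub ht)).mono hsub)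
    refine h1.congr_deriv ?_
    have h2 := dom_sub hdomA hAlin (a2 t (hsub ht)) (hBdom (d t))
    have h3 := dom_sub hdomA hBoplin (a2 t (hsub ht)) (hBdom (d t))
    rw [hBlift, a6 t (hsub ht), sub_self] at h3
    have h4 := hadj (z t) (hz t ht) _ h2.1 h3.2
    rw [h2.2, inner_sub_right, inner_sub_right] at h4
    rw [inner_add_left, inner_add_right]
    linear_combination -h4
  have hFTC := intervalIntegral.integral_eq_sub_of_hasDeriv_right_of_le hT.le
    (fun t ht => (hder t ht).continuousWithinAt)
    (fun t ht => ((hder t (Ioo_subset_Icc_self ht)).hasDerivAt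
      (Icc_mem_nhds ht.1 ht.2)).hasDerivWithinAt) (((i1.sub i2).add i3).add i4)
  rw [intervalIntegral.integral_add ((i1.sub i2).add i3) i4,
    intervalIntegral.integral_add (i1.sub i2) i3, intervalIntegral.integral_sub i1 i2,
    hzT, inner_zero_left, a5] at hFTC
  linear_combination hFTC

/-- convergence of the integrals -/
lemma lim_inner {T : ℝ} (hT : 0 < T) {f G : ℝ → H} {g : ℕ → ℝ → H} {e : ℕ → ℝ}
    (hf : ContinuousOn f (Icc 0 T)) (hg : ∀ n, ContinuousOn (g n) (Icc 0 T))
    (hG : ContinuousOn G (Icc 0 T)) (he : Tendsto e atTop (𝓝 0))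
    (hle : ∀ n, ∀ t ∈ Icc 0 T, ‖g n t - G t‖ ≤ e n) :
    Tendsto (fun n => ∫ t in (0:ℝ)..T, ⟪f t, g n t⟫) atTop (𝓝 (∫ t in (0:ℝ)..T, ⟪f t, G t⟫)) := by
  have ii : ∀ {f : ℝ → ℂ}, ContinuousOn f (Icc 0 T) → IntervalIntegrable f volume 0 T := by
    intro f hf
    apply ContinuousOn.intervalIntegrable
    rwa [uIcc_of_le hT.le]
  obtain ⟨M, hM⟩ := isCompact_Icc.exists_bound_of_continuousOn hf
  rw [tendsto_iff_norm_sub_tendsto_zero]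
  have b0 : Tendsto (fun n => (M * e n) * |T - 0|) atTop (𝓝 0) := by
    have := (he.const_mul M).mul_const |T - 0|
    simpa using this
  refine squeeze_zero (fun _ => norm_nonneg _) (fun n => ?_) b0
  rw [← intervalIntegral.integral_sub (ii (hf.inner (𝕜 := ℂ) (hg n))) (ii (hf.inner (𝕜 := ℂ) hG))]
  refine intervalIntegral.norm_integral_le_of_norm_le_const (fun s hs => ?_)
  rw [uIoc_of_le hT.le] at hs
  have hs' : s ∈ Icc 0 T := ⟨hs.1.le, hs.2⟩
  rw [← inner_sub_right]
  refine (norm_inner_le_norm _ _).trans ?_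
  have := hM s hs'
  exact mul_le_mul this (hle n s hs') (norm_nonneg _) ((norm_nonneg _).trans this)

lemma weak_unique {m : ℕ} {domA : Set H} {A : H → H} {Bop : H → EuclideanSpace ℂ (Fin m)}
    (hdomA : ∀ x ∈ domA, ∀ y ∈ domA, ∀ a b : ℂ, a • x + b • y ∈ domA)
    (hAlin : IsLinearOn A domA) (hBoplin : IsLinearOn Bop domA)
    {domAstar : Set H} {Astar : H → H}
    (hdense : Dense {x : H | x ∈ domA ∧ Bop x = 0})
    (hadjdom : ∀ z : H, z ∈ domAstar ↔ ∃ w : H, ∀ x ∈ domA, Bop x = 0 → ⟪w, x⟫ = ⟪z, A x⟫)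
    (hadj : ∀ z ∈ domAstar, ∀ x ∈ domA, Bop x = 0 → ⟪Astar z, x⟫ = ⟪z, A x⟫)
    {B : EuclideanSpace ℂ (Fin m) →L[ℂ] H}
    {S : ℝ → H →L[ℂ] H}
    (hS : IsC0SemigroupGeneratedBy S {x : H | x ∈ domA ∧ Bop x = 0} A)
    (huniq : ∀ X : ℝ → H, IsClassicalSolution A Bop domA 0 (fun _ => 0) (fun _ => 0) X →
      ∀ t ∈ Ici (0:ℝ), X t = 0)
    {x0 : H} {d : ℝ → EuclideanSpace ℂ (Fin m)} {U X Y : ℝ → H}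
    (hX : IsWeakSolution A domAstar Astar B x0 d U X)
    (hY : IsWeakSolution A domAstar Astar B x0 d U Y) :
    ∀ t ∈ Ici (0:ℝ), Y t = X t := by
  have hclosed := sg_closed S _ A hS
  have h00 : (0:H) ∈ domA ∧ Bop 0 = 0 := by
    obtain ⟨x, hx⟩ := hdense.nonempty
    have h1 := hdomA x hx.1 x hx.1 0 0
    have h2 := hBoplin.2 0 x hx.1
    simp only [zero_smul, add_zero] at h1 h2
    exact ⟨h1, h2⟩
  let D : Submodule ℂ H :=
    { carrier := {x : H | x ∈ domA ∧ Bop x = 0}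
      zero_mem' := h00
      add_mem' := by
        rintro a b ⟨ha, ha'⟩ ⟨hb, hb'⟩
        refine ⟨by simpa using hdomA a ha b hb 1 1, ?_⟩
        rw [hBoplin.1 a ha b hb, ha', hb', add_zero]
      smul_mem' := by
        rintro c a ⟨ha, ha'⟩
        refine ⟨by simpa using hdomA a ha a ha c 0, ?_⟩
        rw [hBoplin.2 c a ha, ha', smul_zero] }
  -- adjoint values are determined
  have hstar : ∀ z w : H, (∀ x ∈ D, ⟪w, x⟫ = ⟪z, A x⟫) → z ∈ domAstar ∧ Astar z = w := by
    intro z w hzw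
    have hz : z ∈ domAstar := (hadjdom z).2 ⟨w, fun x hx hx' => hzw x ⟨hx, hx'⟩⟩
    refine ⟨hz, ?_⟩
    refine hdense.eq_of_inner_left (𝕜 := ℂ) (fun v hv => ?_)
    rw [hadj z hz v hv.1 hv.2, hzw v hv]
  let W : ℝ → H := fun t => Y (max t 0) - X (max t 0)
  have hWc : Continuous W := (aux_cont_max hY.1).sub (aux_cont_max hX.1)
  let w : ℝ → H := fun t => ∫ s in (0:ℝ)..t, W s
  have htWc : Continuous (fun s : ℝ => s • W s) := continuous_id.smul hWc
  have hw : ∀ t, HasDerivAt w (W t) t := fun t =>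
    intervalIntegral.integral_hasDerivAt_right (hWc.intervalIntegrable _ _)
      hWc.stronglyMeasurable.stronglyMeasurableAtFilter hWc.continuousAt
  let v : ℝ → H := fun t => t • w t - ∫ s in (0:ℝ)..t, s • W s
  have hv : ∀ t, HasDerivAt v (w t) t := by
    intro t
    have h1 := (hasDerivAt_id t).smul (hw t)
    have h2 := h1.sub (intervalIntegral.integral_hasDerivAt_right (htWc.intervalIntegrable 0 t)
      htWc.stronglyMeasurable.stronglyMeasurableAtFilter htWc.continuousAt)
    refine HasDerivAt.congr_deriv h2 ?_
    simp
  have hv0 : v 0 = 0 := by simp [v]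
  have key : ∀ T ∈ Ici (0:ℝ), v T ∈ D ∧ A (v T) = w T := by
    intro T hT
    rcases eq_or_lt_of_le (show 0 ≤ T from hT) with rfl | hT
    · rw [hv0, show w 0 = 0 by simp [w]]
      exact ⟨D.zero_mem, by simpa using hAlin.2 0 0 h00.1⟩
    refine biadj D A (fun x hx y hy => hAlin.1 x hx.1 y hy.1) (fun c x hx => hAlin.2 c x hx.1)
      hclosed _ _ (fun z p hzp => ?_)
    have hsc : ∀ t : ℝ, (T - t) • z ∈ domAstar ∧ Astar ((T - t) • z) = (T - t) • p := by
      intro t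
      refine hstar _ _ (fun x hx => ?_)
      rw [← Complex.coe_smul, ← Complex.coe_smul, inner_smul_left, inner_smul_left, hzp x hx]
    have hzd : ∀ t ∈ Icc (0:ℝ) T, HasDerivWithinAt (fun t : ℝ => (T - t) • z) (-z) (Icc 0 T) t := by
      intro t _
      have := (((hasDerivAt_id t).const_sub T).smul_const z).hasDerivWithinAt (s := Icc 0 T)
      simpa using this
    have hAc : Continuous (fun t => Astar ((T - t) • z)) := by
      simp_rw [fun t => (hsc t).2]
      fun_prop
    have eX := hX.2 T hT (fun t => (T - t) • z) (fun _ => -z) (fun t _ => (hsc t).1) hzd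
      continuousOn_const hAc.continuousOn (by simp)
    have eY := hY.2 T hT (fun t => (T - t) • z) (fun _ => -z) (fun t _ => (hsc t).1) hzd
      continuousOn_const hAc.continuousOn (by simp)
    have e := eY.trans eX.symm
    simp_rw [fun t => (hsc t).2] at e
    have hfc : Continuous (fun t : ℝ => (T - t) • p + -z) := by fun_prop
    have ii : ∀ {f : ℝ → ℂ}, ContinuousOn f (Icc 0 T) → IntervalIntegrable f volume 0 T := by
      intro f hf
      apply ContinuousOn.intervalIntegrable
      rwa [uIcc_of_le hT.le]
    have hsub : Icc 0 T ⊆ Ici (0:ℝ) := Icc_subset_Ici_self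
    rw [← sub_eq_zero, ← intervalIntegral.integral_sub
      (ii (hfc.continuousOn.inner (𝕜 := ℂ) (hY.1.mono hsub)))
      (ii (hfc.continuousOn.inner (𝕜 := ℂ) (hX.1.mono hsub)))] at e
    have e2 : ∫ t in (0:ℝ)..T, (⟪p, (T - t) • W t⟫ - ⟪z, W t⟫) = 0 := by
      rw [← e]
      refine intervalIntegral.integral_congr (fun t ht => ?_)
      rw [uIcc_of_le hT.le] at ht
      simp only [W, max_eq_left ht.1]
      rw [← inner_sub_right, inner_add_left, inner_neg_left, ← Complex.coe_smul,
        ← Complex.coe_smul, inner_smul_left, inner_smul_right, Complex.conj_ofReal, sub_eq_add_neg]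
    have hcW : Continuous (fun t : ℝ => (T - t) • W t) := by fun_prop
    rw [intervalIntegral.integral_sub
      (ii ((continuous_const.inner (𝕜 := ℂ) hcW).continuousOn))
      (ii ((continuous_const.inner (𝕜 := ℂ) hWc).continuousOn))] at e2
    have c1 := (innerSL ℂ p).intervalIntegral_comp_comm (hcW.intervalIntegrable (μ := volume) 0 T)
    have c2 := (innerSL ℂ z).intervalIntegral_comp_comm (hWc.intervalIntegrable (μ := volume) 0 T)
    simp only [innerSL_apply_apply] at c1 c2
    have c3 : ∫ t in (0:ℝ)..T, (T - t) • W t = v T := by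
      simp_rw [sub_smul]
      rw [intervalIntegral.integral_sub ((show Continuous (fun t => T • W t) from hWc.const_smul T).intervalIntegrable _ _)
        (htWc.intervalIntegrable _ _), intervalIntegral.integral_smul]
    rw [c1, c2, c3] at e2
    exact (sub_eq_zero.1 e2).symm
  have hvz := huniq v ⟨fun t _ => (hv t).continuousAt.continuousWithinAt,
    fun t ht => (key t ht).1.1,
    (show ContinuousOn w (Ici 0) from fun t _ => (hw t).continuousAt.continuousWithinAt).congr
      (fun t ht => (key t ht).2),
    fun t ht => by rw [(key t ht).2, add_zero]; exact (hv t).hasDerivWithinAt, hv0,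
    fun t ht => (key t ht).1.2⟩
  have dz : ∀ f g : ℝ → H, (∀ t, HasDerivAt f (g t) t) → (∀ t ∈ Ici (0:ℝ), f t = 0) →
      ∀ t ∈ Ici (0:ℝ), g t = 0 := by
    intro f g hfg hf t ht
    have h1 := (hfg t).hasDerivWithinAt (s := Ici 0)
    have h2 : HasDerivWithinAt f 0 (Ici 0) t :=
      (hasDerivWithinAt_const t (Ici 0) (0:H)).congr hf (hf t ht)
    exact (uniqueDiffOn_Ici (0:ℝ) t ht).eq_deriv _ h1 h2
  have hwz := dz v w hv hvz
  have hWz := dz w W hw hwz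
  intro t ht
  have := hWz t ht
  simp only [W, max_eq_left (show 0 ≤ t from ht)] at this
  exact sub_eq_zero.1 this

lemma sSup_img_nonneg {E : Type*} [NormedAddCommGroup E] (f : ℝ → E) (t : ℝ) :
    0 ≤ sSup ((fun s => ‖f s‖) '' Icc 0 t) := by
  refine Real.sSup_nonneg ?_
  rintro _ ⟨s, -, rfl⟩
  exact norm_nonneg _

lemma sSup_img_le {E : Type*} [NormedAddCommGroup E] (f : ℝ → E) (t c : ℝ) (ht : 0 ≤ t)
    (h : ∀ s ∈ Icc 0 t, ‖f s‖ ≤ c) : sSup ((fun s => ‖f s‖) '' Icc 0 t) ≤ c := by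
  refine csSup_le ((nonempty_Icc.2 ht).image _) ?_
  rintro _ ⟨s, hs, rfl⟩
  exact h s hs

lemma sSup_img_le_add {E : Type*} [NormedAddCommGroup E] (f g : ℝ → E) (t c : ℝ) (ht : 0 ≤ t)
    (hg : ContinuousOn g (Ici 0)) (h : ∀ s ∈ Icc 0 t, ‖f s - g s‖ ≤ c) :
    sSup ((fun s => ‖f s‖) '' Icc 0 t) ≤ sSup ((fun s => ‖g s‖) '' Icc 0 t) + c := by
  refine sSup_img_le f t _ ht (fun s hs => ?_)
  have hb : BddAbove ((fun s => ‖g s‖) '' Icc 0 t) :=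
    (isCompact_Icc.image_of_continuousOn (hg.mono Icc_subset_Ici_self).norm).bddAbove
  have h1 : ‖g s‖ ≤ sSup ((fun s => ‖g s‖) '' Icc 0 t) := le_csSup hb ⟨s, hs, rfl⟩
  have h2 : ‖f s‖ ≤ ‖g s‖ + ‖f s - g s‖ := by
    have := norm_add_le (g s) (f s - g s)
    simpa using this
  linarith [h s hs]

lemma classK_mono {γ : ℝ → ℝ} (h : ClassK γ) {a b : ℝ} (ha : 0 ≤ a) (hab : a ≤ b) : γ a ≤ γ b :=
  h.2.1.monotoneOn ha (ha.trans hab) hab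

lemma classK_tendsto {γ : ℝ → ℝ} (h : ClassK γ) {u : ℕ → ℝ} {a : ℝ} (ha : 0 ≤ a)
    (hu : ∀ n, 0 ≤ u n) (hlim : Tendsto u atTop (𝓝 a)) :
    Tendsto (fun n => γ (u n)) atTop (𝓝 (γ a)) :=
  (h.1 a ha).tendsto.comp (tendsto_nhdsWithin_iff.2 ⟨hlim, Eventually.of_forall hu⟩)

lemma classKL_le {β : ℝ → ℝ → ℝ} (h : ClassKL β) {x t : ℝ} (hx : 0 ≤ x) (ht : 0 ≤ t) :
    β x t ≤ β x 0 := by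
  rcases eq_or_lt_of_le hx with rfl | hx
  · have h1 := (h.2.1 t ht).2.2.1
    have h2 := (h.2.1 0 (mem_Ici.2 le_rfl)).2.2.1
    simp only at h1 h2
    rw [h1, h2]
  · exact (h.2.2 x hx).1.antitoneOn (mem_Ici.2 le_rfl) ht ht

lemma approx_fun {E : Type*} [NormedAddCommGroup E] [NormedSpace ℝ E] {f : ℝ → E}
    (hf : ContinuousOn f (Ici 0)) (k : ℕ∞) {e : ℝ} (he : 0 < e) :
    ∃ g : ℝ → E, ContDiff ℝ k g ∧ ∀ t ∈ Ici (0:ℝ), ‖g t - f t‖ ≤ e := by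
  obtain ⟨g, hg, hg', -⟩ := (aux_cont_max hf).exists_contDiff_approx k
    (continuous_const (y := e)) (fun _ => he)
  refine ⟨g, hg, fun t ht => ?_⟩
  have := (hg' t).le
  rwa [dist_eq_norm, max_eq_left (show 0 ≤ t from ht)] at this

end helpers
/-- Existence, uniqueness and ISS estimate for weak solutions (Theorem 3 of the paper). -/
theorem statement_15 {H : Type*} [NormedAddCommGroup H] [InnerProductSpace ℂ H] [CompleteSpace H]
    [TopologicalSpace.SeparableSpace H]
    {m : ℕ} (hm : 0 < m)
    (domA : Set H) (A : H → H) (Bop : H → EuclideanSpace ℂ (Fin m))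
    (hdomA : ∀ x ∈ domA, ∀ y ∈ domA, ∀ a b : ℂ, a • x + b • y ∈ domA)
    (hAlin : IsLinearOn A domA) (hBoplin : IsLinearOn Bop domA)
    (domAstar : Set H) (Astar : H → H)
    (hdense : Dense {x : H | x ∈ domA ∧ Bop x = 0})
    (hadjdom : ∀ z : H, z ∈ domAstar ↔ ∃ w : H, ∀ x ∈ domA, Bop x = 0 → ⟪w, x⟫ = ⟪z, A x⟫)
    (hadj : ∀ z ∈ domAstar, ∀ x ∈ domA, Bop x = 0 → ⟪Astar z, x⟫ = ⟪z, A x⟫)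
    (B : EuclideanSpace ℂ (Fin m) →L[ℂ] H)
    (hBdom : ∀ v, B v ∈ domA) (hBlift : ∀ v, Bop (B v) = v)
    (hABcont : Continuous fun v => A (B v))
    (S : ℝ → H →L[ℂ] H)
    (hS : IsC0SemigroupGeneratedBy S {x : H | x ∈ domA ∧ Bop x = 0} A)
    (β : ℝ → ℝ → ℝ) (γ1 γ2 : ℝ → ℝ)
    (hβ : ClassKL β) (hγ1 : ClassK γ1) (hγ2 : ClassK γ2)
    (hexist : ∀ (X0 : H) (d : ℝ → EuclideanSpace ℂ (Fin m)) (U : ℝ → H),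
      X0 ∈ domA → ContDiffOn ℝ 2 d (Set.Ici 0) → ContDiffOn ℝ 1 U (Set.Ici 0) → Bop X0 = d 0 →
      ∃ X : ℝ → H, IsClassicalSolution A Bop domA X0 d U X)
    (hISS : ∀ (X0 : H) (d : ℝ → EuclideanSpace ℂ (Fin m)) (U : ℝ → H) (X : ℝ → H),
      X0 ∈ domA → ContDiffOn ℝ 2 d (Set.Ici 0) → ContDiffOn ℝ 1 U (Set.Ici 0) → Bop X0 = d 0 →
      IsClassicalSolution A Bop domA X0 d U X →
      ∀ t ∈ Set.Ici (0:ℝ),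
        ‖X t‖ ≤ β ‖X0‖ t + γ1 (sSup ((fun s => ‖d s‖) '' Set.Icc 0 t))
          + γ2 (sSup ((fun s => ‖U s‖) '' Set.Icc 0 t))) :
    ∀ (X0 : H) (d : ℝ → EuclideanSpace ℂ (Fin m)) (U : ℝ → H),
      ContinuousOn d (Set.Ici 0) → ContinuousOn U (Set.Ici 0) →
      ∃ X : ℝ → H,
        IsWeakSolution A domAstar Astar B X0 d U X ∧
        (∀ Y : ℝ → H, IsWeakSolution A domAstar Astar B X0 d U Y →
          ∀ t ∈ Set.Ici (0:ℝ), Y t = X t) ∧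
        ∀ t ∈ Set.Ici (0:ℝ),
          ‖X t‖ ≤ β ‖X0‖ t + γ1 (sSup ((fun s => ‖d s‖) '' Set.Icc 0 t))
            + γ2 (sSup ((fun s => ‖U s‖) '' Set.Icc 0 t)) := by
  intro X0 d U hd hU
  open Set Filter Topology MeasureTheory in
  have huniq : ∀ X : ℝ → H, IsClassicalSolution A Bop domA 0 (fun _ => 0) (fun _ => 0) X →
      ∀ t ∈ Ici (0:ℝ), X t = 0 := by
    intro X hX t ht
    have h0 : (0:H) ∈ domA := by simpa using hBdom 0
    have h0' : Bop (0:H) = 0 := by simpa using hBlift 0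
    have h1 := hISS 0 (fun _ => 0) (fun _ => 0) X h0 contDiffOn_const contDiffOn_const h0' hX t ht
    have hne : (Icc 0 t).Nonempty := nonempty_Icc.2 ht
    have hb := (hβ.2.1 t ht).2.2.1
    simp only at hb
    simp only [norm_zero, hne.image_const, csSup_singleton, hγ1.2.2.1, hγ2.2.2.1, hb] at h1
    exact norm_le_zero_iff.1 (by linarith)
  -- the bounded operator `A ∘ B`
  let AB : EuclideanSpace ℂ (Fin m) →L[ℂ] H :=
    { toFun := fun v => A (B v)
      map_add' := fun v w => by rw [map_add, hAlin.1 _ (hBdom v) _ (hBdom w)]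
      map_smul' := fun c v => by rw [map_smul, hAlin.2 c _ (hBdom v)]; rfl
      cont := hABcont }
  have hAB : ∀ v, AB v = A (B v) := fun v => rfl
  let e : ℕ → ℝ := fun n => 1 / ((n:ℝ) + 1)
  have he : ∀ n, 0 < e n := fun n => by positivity
  have he0 : Filter.Tendsto e Filter.atTop (nhds 0) := tendsto_one_div_add_atTop_nhds_zero_nat
  have heanti : ∀ {n k}, n ≤ k → e k ≤ e n := fun h => one_div_le_one_div_of_le (by positivity)
    (by gcongr)
  choose dn hdn hdn' using fun n => approx_fun hd 2 (he n)
  choose Un hUn hUn' using fun n => approx_fun hU 1 (he n)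
  have hy : ∀ n, ∃ y ∈ {x : H | x ∈ domA ∧ Bop x = 0}, dist (X0 - B (d 0)) y < e n := fun n =>
    hdense.exists_dist_lt _ (he n)
  choose y hyD hyd using hy
  have h00 : (0:ℝ) ∈ Set.Ici (0:ℝ) := Set.mem_Ici.2 le_rfl
  let C : ℝ := ‖B‖ + 1
  have hC : 0 ≤ C := by positivity
  let x : ℕ → H := fun n => B (dn n 0) + y n
  have hx : ∀ n, x n ∈ domA ∧ Bop (x n) = dn n 0 := by
    intro n
    refine ⟨by simpa using hdomA _ (hBdom (dn n 0)) _ (hyD n).1 1 1, ?_⟩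
    rw [hBoplin.1 _ (hBdom _) _ (hyD n).1, hBlift, (hyD n).2, add_zero]
  have hxd : ∀ n, ‖x n - X0‖ ≤ C * e n := by
    intro n
    have h1 : x n - X0 = B (dn n 0 - d 0) - (X0 - B (d 0) - y n) := by
      simp only [x, map_sub]; abel
    have h2 : ‖B (dn n 0 - d 0)‖ ≤ ‖B‖ * e n :=
      (B.le_opNorm _).trans (by gcongr; exact hdn' n 0 h00)
    have h3 := hyd n
    rw [dist_eq_norm] at h3
    rw [h1]
    calc _ ≤ _ := norm_sub_le _ _
      _ ≤ ‖B‖ * e n + e n := by linarith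
      _ = C * e n := by ring
  choose X hX using fun n => hexist (x n) (dn n) (Un n) (hx n).1 ((hdn n).contDiffOn)
    ((hUn n).contDiffOn) (hx n).2
  let b : ℕ → ℝ := fun N => β (C * (2 * e N)) 0 + γ1 (2 * e N) + γ2 (2 * e N)
  have h2e : Filter.Tendsto (fun n => 2 * e n) Filter.atTop (nhds 0) := by
    simpa using he0.const_mul 2
  have hb0 : Filter.Tendsto b Filter.atTop (nhds 0) := by
    have h1 := classK_tendsto (hβ.2.1 0 h00) (a := 0) (u := fun n => C * (2 * e n)) le_rfl
      (fun n => by have := he n; positivity) (by simpa using h2e.const_mul C)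
    have h2 := classK_tendsto hγ1 (a := 0) le_rfl (fun n => by have := he n; positivity) h2e
    have h3 := classK_tendsto hγ2 (a := 0) le_rfl (fun n => by have := he n; positivity) h2e
    have h4 := (hβ.2.1 0 h00).2.2.1
    simp only at h4
    simpa [h4, hγ1.2.2.1, hγ2.2.2.1] using (h1.add h2).add h3
  have hdist : ∀ t ∈ Set.Ici (0:ℝ), ∀ n k N, N ≤ n → N ≤ k → dist (X n t) (X k t) ≤ b N := by
    intro t ht n k N hn hk
    have ht' : 0 ≤ t := ht
    have hnN := heanti hn
    have hkN := heanti hk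
    have h1 := hISS _ _ _ _ (dom_sub hdomA hBoplin (hx n).1 (hx k).1).1
      (((hdn n).sub (hdn k)).contDiffOn) (((hUn n).sub (hUn k)).contDiffOn)
      (by rw [(dom_sub hdomA hBoplin (hx n).1 (hx k).1).2, (hx n).2, (hx k).2])
      (classical_sub hdomA hAlin hBoplin (hX n) (hX k)) t ht
    rw [dist_eq_norm]
    refine h1.trans ?_
    have tri : ∀ {E : Type _} [NormedAddCommGroup E] (p q r : E) (c : ℝ), ‖p - r‖ ≤ c →
        ‖q - r‖ ≤ c → ‖p - q‖ ≤ 2 * c := by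
      intro E _ p q r c h1 h2
      have := norm_sub_le (p - r) (q - r)
      rw [sub_sub_sub_cancel_right] at this
      linarith
    have tri2 : ∀ {E : Type _} [NormedAddCommGroup E] (p q r : E) (c : ℝ), ‖p - r‖ ≤ c →
        ‖q - r‖ ≤ c → ‖p - q‖ ≤ 2 * c := by
      intro E _ p q r c h1 h2
      have := norm_sub_le (p - r) (q - r)
      rw [sub_sub_sub_cancel_right] at this
      linarith
    refine add_le_add (add_le_add ?_ ?_) ?_
    · refine (classKL_le hβ (norm_nonneg _) ht').trans ?_
      refine classK_mono (hβ.2.1 0 h00) (norm_nonneg _) ?_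
      have := tri (x n) (x k) X0 (C * e N) ((hxd n).trans (by gcongr)) ((hxd k).trans (by gcongr))
      linarith
    · refine classK_mono hγ1 (sSup_img_nonneg _ _) (sSup_img_le _ _ _ ht' fun s hs => ?_)
      exact tri2 _ _ (d s) _ ((hdn' n s hs.1).trans hnN) ((hdn' k s hs.1).trans hkN)
    · refine classK_mono hγ2 (sSup_img_nonneg _ _) (sSup_img_le _ _ _ ht' fun s hs => ?_)
      exact tri _ _ (U s) _ ((hUn' n s hs.1).trans hnN) ((hUn' k s hs.1).trans hkN)
  have hlim : ∀ t, ∃ p : H, t ∈ Set.Ici (0:ℝ) →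
      Filter.Tendsto (fun n => X n t) Filter.atTop (nhds p) := by
    intro t
    by_cases ht : t ∈ Set.Ici (0:ℝ)
    · obtain ⟨p, hp⟩ := cauchySeq_tendsto_of_complete
        (cauchySeq_of_le_tendsto_0 b (hdist t ht) hb0)
      exact ⟨p, fun _ => hp⟩
    · exact ⟨0, fun h => absurd h ht⟩
  choose Xl hXl using hlim
  have hXb : ∀ n, ∀ t ∈ Set.Ici (0:ℝ), ‖X n t - Xl t‖ ≤ b n := by
    intro n t ht
    have h1 := (tendsto_const_nhds (x := X n t)).dist (hXl t ht)
    rw [← dist_eq_norm]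
    refine le_of_tendsto h1 ?_
    filter_upwards [Filter.eventually_ge_atTop n] with k hk
    exact hdist t ht n k n le_rfl hk
  have hunif : TendstoUniformlyOn X Xl Filter.atTop (Set.Ici 0) := by
    rw [Metric.tendstoUniformlyOn_iff]
    intro ε hε
    filter_upwards [hb0.eventually_lt_const hε] with n hn t ht
    rw [dist_comm, dist_eq_norm]
    exact (hXb n t ht).trans_lt hn
  have hXlc : ContinuousOn Xl (Set.Ici 0) :=
    hunif.continuousOn (Filter.Frequently.of_forall fun n => (hX n).1)
  have hweak : IsWeakSolution A domAstar Astar B X0 d U Xl := by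
    refine ⟨hXlc, fun T hT z z' hz hzd hz' hAz hzT => ?_⟩
    have hsub : Set.Icc 0 T ⊆ Set.Ici (0:ℝ) := Set.Icc_subset_Ici_self
    have hzc : ContinuousOn z (Set.Icc 0 T) := fun t ht => (hzd t ht).continuousWithinAt
    have hn : ∀ n, _ := fun n => (classical_weak hdomA hAlin hBoplin hadj hBdom hBlift hABcont
      ((hdn n).continuous.continuousOn) ((hUn n).continuous.continuousOn) (hX n)).2
        T hT z z' hz hzd hz' hAz hzT
    have l0 := lim_inner hT (show ContinuousOn (fun t => Astar (z t) + z' t) (Set.Icc 0 T) from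
      hAz.add hz') (fun n => (hX n).1.mono hsub) (hXlc.mono hsub) hb0
      (fun n t ht => hXb n t (hsub ht))
    have l1 := lim_inner hT hAz (G := fun t => B (d t)) (g := fun n t => B (dn n t))
      (e := fun n => ‖B‖ * e n)
      (fun n => (B.continuous.comp (hdn n).continuous).continuousOn)
      (B.continuous.comp_continuousOn (hd.mono hsub)) (by simpa using he0.const_mul ‖B‖)
      (fun n t ht => by
        rw [← map_sub]
        exact (B.le_opNorm _).trans (by gcongr; exact hdn' n t (hsub ht)))
    have l2 := lim_inner hT hzc (G := fun t => A (B (d t))) (g := fun n t => A (B (dn n t)))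
      (e := fun n => ‖AB‖ * e n)
      (fun n => (hABcont.comp (hdn n).continuous).continuousOn)
      (hABcont.comp_continuousOn (hd.mono hsub)) (by simpa using he0.const_mul ‖AB‖)
      (fun n t ht => by
        rw [← hAB, ← hAB, ← map_sub]
        exact (AB.le_opNorm _).trans (by gcongr; exact hdn' n t (hsub ht)))
    have l3 := lim_inner hT hzc (fun n => (hUn n).continuous.continuousOn) (hU.mono hsub) he0
      (fun n t ht => hUn' n t (hsub ht))
    have lx : Filter.Tendsto x Filter.atTop (nhds X0) := by
      rw [tendsto_iff_norm_sub_tendsto_zero]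
      exact squeeze_zero (fun _ => norm_nonneg _) hxd (by simpa using he0.const_mul C)
    have l4 : Filter.Tendsto (fun n => -⟪z 0, x n⟫) Filter.atTop (nhds (-⟪z 0, X0⟫)) :=
      ((tendsto_const_nhds (x := z 0)).inner lx).neg
    exact tendsto_nhds_unique l0 ((((l4.add l1).sub l2).sub l3).congr fun n => (hn n).symm)
  refine ⟨Xl, hweak, fun Y hY => weak_unique hdomA hAlin hBoplin hdense hadjdom hadj hS huniq
    hweak hY, fun t ht => ?_⟩
  have ht' : 0 ≤ t := ht
  have n1 := sSup_img_nonneg d t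
  have n2 := sSup_img_nonneg U t
  have hr : Filter.Tendsto (fun n => β (‖X0‖ + C * e n) t
      + γ1 (sSup ((fun s => ‖d s‖) '' Set.Icc 0 t) + e n)
      + γ2 (sSup ((fun s => ‖U s‖) '' Set.Icc 0 t) + e n)) Filter.atTop
      (nhds (β ‖X0‖ t + γ1 (sSup ((fun s => ‖d s‖) '' Set.Icc 0 t))
          + γ2 (sSup ((fun s => ‖U s‖) '' Set.Icc 0 t)))) := by
    refine Filter.Tendsto.add (Filter.Tendsto.add ?_ ?_) ?_
    · exact classK_tendsto (hβ.2.1 t ht) (norm_nonneg _)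
        (fun n => by have := he n; positivity)
        (by simpa using (he0.const_mul C).const_add ‖X0‖)
    · exact classK_tendsto hγ1 n1 (fun n => by have := he n; positivity)
        (by simpa using he0.const_add _)
    · exact classK_tendsto hγ2 n2 (fun n => by have := he n; positivity)
        (by simpa using he0.const_add _)
  refine le_of_tendsto_of_tendsto' (hXl t ht).norm hr (fun n => ?_)
  refine (hISS _ _ _ _ (hx n).1 ((hdn n).contDiffOn) ((hUn n).contDiffOn) (hx n).2 (hX n)
    t ht).trans (add_le_add (add_le_add ?_ ?_) ?_)
  · refine classK_mono (hβ.2.1 t ht) (norm_nonneg _) ?_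
    have := norm_add_le X0 (x n - X0)
    rw [add_sub_cancel] at this
    linarith [hxd n]
  · exact classK_mono hγ1 (sSup_img_nonneg _ _)
      (sSup_img_le_add _ _ _ _ ht' hd fun s hs => hdn' n s hs.1)
  · exact classK_mono hγ2 (sSup_img_nonneg _ _)
      (sSup_img_le_add _ _ _ _ ht' hU fun s hs => hUn' n s hs.1)
end
end

section
/- Suppose S is a strongly continuous semigroup on H generated by 𝒜₀, and suppose the ISS and existence hypotheses hold. Let X₀ ∈ H, let d : [0,∞) → ℂ^m be continuously differentiable and let U : [0,∞) → H be continuous, and let X be the weak solution associated with (X₀, d, U). Then X is a mild solution: for all t ≥ 0, X(t) = S(t)(X₀ − B d(0)) + B d(t) + ∫₀ᵗ S(t−τ)( −B d′(τ) + 𝒜 B d(τ) + U(τ) ) dτ. -/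
noncomputable section

local notation "⟪" x ", " y "⟫" => @inner ℂ _ _ x y

open Set Filter Topology MeasureTheory in
lemma sg_bound {H : Type*} [NormedAddCommGroup H] [InnerProductSpace ℂ H] [CompleteSpace H]
    (T : ℝ → H →L[ℂ] H) (hT : ∀ x, Continuous fun t => T t x) (a b : ℝ) :
    ∃ C, 0 ≤ C ∧ ∀ t ∈ Icc a b, ‖T t‖ ≤ C := by
  have := banach_steinhaus (g := fun t : Icc a b => T t) (fun x => by
    obtain ⟨C, hC⟩ := (isCompact_Icc (a := a) (b := b)).exists_bound_of_continuousOn (hT x).continuousOn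
    exact ⟨C, fun i => hC i i.2⟩)
  obtain ⟨C, hC⟩ := this
  exact ⟨max C 0, le_max_right _ _, fun t ht => (hC ⟨t, ht⟩).trans (le_max_left _ _)⟩

open Set Filter Topology MeasureTheory in
lemma sg_tendsto {H : Type*} [NormedAddCommGroup H] [InnerProductSpace ℂ H] [CompleteSpace H]
    (T : ℝ → H →L[ℂ] H) (hT : ∀ x, Continuous fun t => T t x) {ι : Type*} {l : Filter ι}
    {u : ι → ℝ} {f : ι → H} {a : ℝ} {y : H} (hu : Tendsto u l (𝓝 a)) (hf : Tendsto f l (𝓝 y)) :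
    Tendsto (fun i => T (u i) (f i)) l (𝓝 (T a y)) := by
  obtain ⟨C, hC0, hC⟩ := sg_bound T hT (a - 1) (a + 1)
  have h1 : Tendsto (fun i => T (u i) y) l (𝓝 (T a y)) := ((hT y).tendsto a).comp hu
  have h2 : Tendsto (fun i => T (u i) (f i - y)) l (𝓝 0) := by
    have hev : ∀ᶠ i in l, u i ∈ Icc (a - 1) (a + 1) :=
      hu.eventually (Icc_mem_nhds (by linarith) (by linarith))
    have h3 : Tendsto (fun i => C * ‖f i - y‖) l (𝓝 0) := by
      have := (tendsto_iff_norm_sub_tendsto_zero.1 hf).const_mul C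
      simpa using this
    refine squeeze_zero_norm' ?_ h3
    filter_upwards [hev] with i hi
    exact ((T (u i)).le_opNorm _).trans (by gcongr; exact hC _ hi)
  have := h2.add h1
  simpa using this

open Set Filter Topology MeasureTheory in
lemma sg_cont {H : Type*} [NormedAddCommGroup H] [InnerProductSpace ℂ H] [CompleteSpace H]
    (T : ℝ → H →L[ℂ] H) (hT : ∀ x, Continuous fun t => T t x)
    {u : ℝ → ℝ} {f : ℝ → H} (hu : Continuous u) (hf : Continuous f) :
    Continuous fun s => T (u s) (f s) :=
  continuous_iff_continuousAt.2 fun s =>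
    sg_tendsto T hT (hu.tendsto s) (hf.tendsto s)

open Set Filter Topology MeasureTheory in
lemma tendsto_shift (s : ℝ) : Tendsto (fun r : ℝ => r - s) (𝓝[>] s) (𝓝[>] 0) := by
  refine tendsto_nhdsWithin_iff.2 ⟨?_, ?_⟩
  · have : Tendsto (fun r : ℝ => r - s) (𝓝 s) (𝓝 (s - s)) := by
      exact (continuous_id.sub continuous_const).tendsto s
    rw [sub_self] at this
    exact this.mono_left nhdsWithin_le_nhds
  · filter_upwards [self_mem_nhdsWithin] with r hr
    simpa using hr

open Set Filter Topology MeasureTheory in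
/-- variation of constants -/
lemma sg_duhamel {H : Type*} [NormedAddCommGroup H] [InnerProductSpace ℂ H] [CompleteSpace H]
    (T : ℝ → H →L[ℂ] H) (hT : ∀ x, Continuous fun t => T t x)
    (hT0 : T 0 = ContinuousLinearMap.id ℂ H)
    (hadd : ∀ t, 0 ≤ t → ∀ s, 0 ≤ s → T (t + s) = (T t).comp (T s))
    (D : Set H) (A : H → H)
    (hgen : ∀ x ∈ D, Tendsto (fun h : ℝ => h⁻¹ • (T h x - x)) (𝓝[>] 0) (𝓝 (A x)))
    (G f : ℝ → H) (hG : Continuous G) (hf : Continuous f) (t : ℝ) (ht : 0 ≤ t)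
    (hGD : ∀ s ∈ Ico 0 t, G s ∈ D)
    (hGd : ∀ s ∈ Ico 0 t, HasDerivWithinAt G (A (G s) + f s) (Ioi s) s) :
    G t = T t (G 0) + ∫ s in (0:ℝ)..t, T (t - s) (f s) := by
  have hc : Continuous fun s => T (t - s) (f s) := sg_cont T hT (by fun_prop) hf
  have hc2 : Continuous fun s => T (t - s) (G s) := sg_cont T hT (by fun_prop) hG
  have key := intervalIntegral.integral_eq_sub_of_hasDeriv_right_of_le (f := fun s => T (t - s) (G s))
    (f' := fun s => T (t - s) (f s)) ht hc2.continuousOn ?_ (hc.intervalIntegrable _ _)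
  · rw [key]; simp [hT0]
  intro s hs
  have hs' : s ∈ Ico 0 t := ⟨hs.1.le, hs.2⟩
  rw [hasDerivWithinAt_iff_tendsto_slope' (by simp)]
  have h1 := (hasDerivWithinAt_iff_tendsto_slope' (by simp)).1 (hGd s hs')
  have h2 := (hgen _ (hGD s hs')).comp (tendsto_shift s)
  have h3 := h1.sub h2
  have hu : Tendsto (fun r : ℝ => t - r) (𝓝[>] s) (𝓝 (t - s)) :=
    ((continuous_const.sub continuous_id).tendsto s).mono_left nhdsWithin_le_nhds
  have h4 := sg_tendsto T hT hu h3
  rw [add_sub_cancel_left] at h4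
  refine h4.congr' ?_
  have hev : ∀ᶠ r in 𝓝[>] s, r < t :=
    nhdsWithin_le_nhds (Iio_mem_nhds hs.2)
  filter_upwards [hev, self_mem_nhdsWithin] with r hr hsr
  have hsr' : s < r := hsr
  have e : T (t - s) = (T (t - r)).comp (T (r - s)) := by
    rw [← hadd _ (by linarith) _ (by linarith)]; congr 1; ring
  simp only [slope_def_module, Function.comp]
  rw [e, ← smul_sub, ContinuousLinearMap.map_smul_of_tower]
  simp

open Set Filter Topology MeasureTheory in
lemma sg_integral_s17 {H : Type*} [NormedAddCommGroup H] [InnerProductSpace ℂ H] [CompleteSpace H]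
    (T : ℝ → H →L[ℂ] H) (hT : ∀ x, Continuous fun t => T t x)
    (hT0 : T 0 = ContinuousLinearMap.id ℂ H)
    (hadd : ∀ t, 0 ≤ t → ∀ s, 0 ≤ s → T (t + s) = (T t).comp (T s))
    (x y : H)
    (hgen : Tendsto (fun h : ℝ => h⁻¹ • (T h x - x)) (𝓝[>] 0) (𝓝 y))
    (h : ℝ) (hh : 0 ≤ h) : ∫ r in (0:ℝ)..h, T r y = T h x - x := by
  have key := intervalIntegral.integral_eq_sub_of_hasDeriv_right_of_le (f := fun s => T s x)
    (f' := fun s => T s y) hh (hT x).continuousOn ?_ ((hT y).intervalIntegrable _ _)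
  · rw [key]; simp [hT0]
  intro s hs
  rw [hasDerivWithinAt_iff_tendsto_slope' (by simp)]
  have h2 := ((T s).continuous.tendsto _).comp (hgen.comp (tendsto_shift s))
  refine h2.congr' ?_
  filter_upwards [self_mem_nhdsWithin] with r hr
  have hr' : s < r := hr
  have e : T r = (T s).comp (T (r - s)) := by
    rw [← hadd _ hs.1.le _ (by linarith)]; congr 1; ring
  simp only [slope_def_module, Function.comp]
  rw [e, ContinuousLinearMap.map_smul_of_tower]
  simp

open Set Filter Topology MeasureTheory in
/-- Ball's lemma: weak membership in the generator. -/
lemma sg_ball {H : Type*} [NormedAddCommGroup H] [InnerProductSpace ℂ H] [CompleteSpace H]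
    (T : ℝ → H →L[ℂ] H) (hT : ∀ x, Continuous fun t => T t x)
    (hT0 : T 0 = ContinuousLinearMap.id ℂ H)
    (hadd : ∀ t, 0 ≤ t → ∀ s, 0 ≤ s → T (t + s) = (T t).comp (T s))
    (D : Set H) (A : H → H) (hdense : Dense D)
    (hgen : ∀ x ∈ D, Tendsto (fun h : ℝ => h⁻¹ • (T h x - x)) (𝓝[>] 0) (𝓝 (A x)))
    (domAstar : Set H) (Astar : H → H)
    (hadjdom : ∀ z : H, z ∈ domAstar ↔ ∃ w : H, ∀ x ∈ D, ⟪w, x⟫ = ⟪z, A x⟫)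
    (hadj : ∀ z ∈ domAstar, ∀ x ∈ D, ⟪Astar z, x⟫ = ⟪z, A x⟫)
    (x y : H) (hxy : ∀ z ∈ domAstar, ⟪z, y⟫ = ⟪Astar z, x⟫) :
    Tendsto (fun h : ℝ => h⁻¹ • (T h x - x)) (𝓝[>] 0) (𝓝 y) := by
  have main : ∀ h : ℝ, 0 ≤ h → T h x - x = ∫ r in (0:ℝ)..h, T r y := by
    intro h hh
    obtain ⟨C, hC0, hC⟩ := sg_bound T hT 0 h
    let J₀ : H →ₗ[ℂ] H :=
      { toFun := fun v => ∫ r in (0:ℝ)..h, T r v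
        map_add' := fun u v => by
          simp only [map_add]
          exact intervalIntegral.integral_add ((hT u).intervalIntegrable _ _)
            ((hT v).intervalIntegrable _ _)
        map_smul' := fun c v => by
          simp only [map_smul]
          exact intervalIntegral.integral_smul c _ }
    let J : H →L[ℂ] H := J₀.mkContinuous (C * h) (fun v => by
      have := intervalIntegral.norm_integral_le_of_norm_le_const (a := (0:ℝ)) (b := h)
        (f := fun r => T r v) (C := C * ‖v‖) (fun r hr => by
          rw [uIoc_of_le hh] at hr
          exact ((T r).le_opNorm v).trans (by gcongr; exact hC r ⟨hr.1.le, hr.2⟩))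
      rw [sub_zero, abs_of_nonneg hh] at this
      calc ‖J₀ v‖ ≤ _ := this
        _ = C * h * ‖v‖ := by ring)
    have hJ : ∀ v, J v = ∫ r in (0:ℝ)..h, T r v := fun v => rfl
    rw [← hJ]
    refine ext_inner_left ℂ fun v => ?_
    have hw : ∀ x' ∈ D, ⟪ContinuousLinearMap.adjoint (T h - ContinuousLinearMap.id ℂ H) v, x'⟫
        = ⟪ContinuousLinearMap.adjoint J v, A x'⟫ := by
      intro x' hx'
      rw [ContinuousLinearMap.adjoint_inner_left, ContinuousLinearMap.adjoint_inner_left, hJ,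
        sg_integral_s17 T hT hT0 hadd x' (A x') (hgen x' hx') h hh]
      simp
    have hz : ContinuousLinearMap.adjoint J v ∈ domAstar := (hadjdom _).2 ⟨_, hw⟩
    have hA : Astar (ContinuousLinearMap.adjoint J v)
        = ContinuousLinearMap.adjoint (T h - ContinuousLinearMap.id ℂ H) v := by
      refine hdense.eq_of_inner_left (𝕜 := ℂ) ?_
      intro x' hx'
      rw [hadj _ hz x' hx', hw x' hx']
    have := hxy _ hz
    rw [hA, ContinuousLinearMap.adjoint_inner_left, ContinuousLinearMap.adjoint_inner_left] at this
    rw [this]; simp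
  have hd : HasDerivWithinAt (fun h => ∫ r in (0:ℝ)..h, T r y) (T 0 y) (Ioi 0) 0 :=
    (intervalIntegral.integral_hasDerivAt_right ((hT y).intervalIntegrable _ _)
      ((hT y).stronglyMeasurableAtFilter _ _) (hT y).continuousAt).hasDerivWithinAt
  rw [hasDerivWithinAt_iff_tendsto_slope' (by simp), hT0] at hd
  refine hd.congr' ?_
  filter_upwards [self_mem_nhdsWithin] with r hr
  simp only [slope_def_module, intervalIntegral.integral_same, sub_zero]
  rw [main r (le_of_lt hr)]

open Set Filter Topology MeasureTheory in
lemma weak_scalar (T : ℝ) (hTpos : 0 < T) (w a : ℝ → ℂ) (hw : Continuous w) (ha : Continuous a)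
    (c : ℂ)
    (hyp : ∀ φ ψ : ℝ → ℂ, (∀ t, HasDerivAt φ (ψ t) t) → Continuous ψ → φ T = 0 →
      ∫ t in (0:ℝ)..T, (starRingEnd ℂ (ψ t) * w t + starRingEnd ℂ (φ t) * a t)
        = - (starRingEnd ℂ (φ 0) * c)) :
    ∀ t ∈ Icc 0 T, w t = c + ∫ s in (0:ℝ)..t, a s := by
  have hI : ∀ t, HasDerivAt (fun t => c + ∫ s in (0:ℝ)..t, a s) (a t) t := fun t =>
    (intervalIntegral.integral_hasDerivAt_right (ha.intervalIntegrable _ _)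
      (ha.stronglyMeasurableAtFilter _ _) ha.continuousAt).const_add c
  have hIc : Continuous (fun t => c + ∫ s in (0:ℝ)..t, a s) :=
    continuous_iff_continuousAt.2 fun t => (hI t).continuousAt
  set I : ℝ → ℂ := fun t => c + ∫ s in (0:ℝ)..t, a s with hIdef
  set g : ℝ → ℂ := fun t => w t - I t with hg
  have hgc : Continuous g := hw.sub hIc
  let φ : ℝ → ℂ := fun t => ∫ s in T..t, g s
  have hφ : ∀ t, HasDerivAt φ (g t) t := fun t =>
    intervalIntegral.integral_hasDerivAt_right (hgc.intervalIntegrable _ _)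
      (hgc.stronglyMeasurableAtFilter _ _) hgc.continuousAt
  have hφc : Continuous φ := continuous_iff_continuousAt.2 fun t => (hφ t).continuousAt
  have hφT : φ T = 0 := intervalIntegral.integral_same
  have h1 := hyp φ g hφ hgc hφT
  have hstar : ∀ t, HasDerivAt (fun t => starRingEnd ℂ (φ t)) (starRingEnd ℂ (g t)) t :=
    fun t => (hφ t).star
  have c1 : Continuous fun t => starRingEnd ℂ (g t) := Complex.continuous_conj.comp hgc
  have c2 : Continuous fun t => starRingEnd ℂ (φ t) := Complex.continuous_conj.comp hφc
  have h2 := intervalIntegral.integral_eq_sub_of_hasDerivAt (a := 0) (b := T)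
    (f := fun t => starRingEnd ℂ (φ t) * I t)
    (f' := fun t => starRingEnd ℂ (g t) * I t + starRingEnd ℂ (φ t) * a t)
    (fun t _ => (hstar t).mul (hI t))
    (((c1.mul hIc).add (c2.mul ha)).intervalIntegrable _ _)
  have hI0 : I 0 = c := by simp [hIdef]
  simp only [hφT, hI0, map_zero, zero_mul, zero_sub] at h2
  have h3 := h1.trans h2.symm
  have i1 : IntervalIntegrable (fun t => starRingEnd ℂ (g t) * w t + starRingEnd ℂ (φ t) * a t)
      volume 0 T := ((c1.mul hw).add (c2.mul ha)).intervalIntegrable _ _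
  have i2 : IntervalIntegrable (fun t => starRingEnd ℂ (g t) * I t + starRingEnd ℂ (φ t) * a t)
      volume 0 T := ((c1.mul hIc).add (c2.mul ha)).intervalIntegrable _ _
  rw [← sub_eq_zero, ← intervalIntegral.integral_sub i1 i2] at h3
  have h4 : ∫ t in (0:ℝ)..T, ((‖g t‖ ^ 2 : ℝ) : ℂ) = 0 := by
    rw [← h3]
    refine intervalIntegral.integral_congr fun t _ => ?_
    have : starRingEnd ℂ (g t) * g t = ((‖g t‖ ^ 2 : ℝ) : ℂ) := by
      rw [Complex.conj_mul']; push_cast; rfl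
    rw [← this]
    simp only [hg]
    ring
  rw [intervalIntegral.integral_ofReal] at h4
  have h5 : ∫ t in (0:ℝ)..T, ‖g t‖ ^ 2 = 0 := by exact_mod_cast h4
  intro t ht
  by_contra hne
  have hgt : g t ≠ 0 := fun h => hne (sub_eq_zero.1 h)
  have := intervalIntegral.integral_pos hTpos ((hgc.norm.pow 2).continuousOn)
    (fun x _ => sq_nonneg _) ⟨t, ht, pow_pos (norm_pos_iff.2 hgt) 2⟩
  exact absurd h5 this.ne'

open Set Filter Topology MeasureTheory in
lemma sg_mild {H : Type*} [NormedAddCommGroup H] [InnerProductSpace ℂ H] [CompleteSpace H]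
    (T : ℝ → H →L[ℂ] H) (hT : ∀ x, Continuous fun t => T t x)
    (hT0 : T 0 = ContinuousLinearMap.id ℂ H)
    (hadd : ∀ t, 0 ≤ t → ∀ s, 0 ≤ s → T (t + s) = (T t).comp (T s))
    (D : Set H) (A : H → H)
    (hgen : ∀ x ∈ D, Tendsto (fun h : ℝ => h⁻¹ • (T h x - x)) (𝓝[>] 0) (𝓝 (A x)))
    (hDsub : ∀ x ∈ D, ∀ y ∈ D, x - y ∈ D ∧ A (x - y) = A x - A y)
    (W V : ℝ → H) (hW : Continuous W) (hV : Continuous V) (W0 : H)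
    (hG : ∀ t, 0 ≤ t → (∫ s in (0:ℝ)..t, W s) ∈ D ∧
      A (∫ s in (0:ℝ)..t, W s) = W t - W0 - ∫ s in (0:ℝ)..t, V s)
    (t : ℝ) (ht : 0 ≤ t) :
    W t = T t W0 + ∫ s in (0:ℝ)..t, T (t - s) (V s) := by
  set G : ℝ → H := fun t => ∫ s in (0:ℝ)..t, W s with hGdef
  set P : ℝ → H := fun t => ∫ s in (0:ℝ)..t, V s with hPdef
  have hGd : ∀ t, HasDerivAt G (W t) t := fun t =>
    intervalIntegral.integral_hasDerivAt_right (hW.intervalIntegrable _ _)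
      (hW.stronglyMeasurableAtFilter _ _) hW.continuousAt
  have hPd : ∀ t, HasDerivAt P (V t) t := fun t =>
    intervalIntegral.integral_hasDerivAt_right (hV.intervalIntegrable _ _)
      (hV.stronglyMeasurableAtFilter _ _) hV.continuousAt
  have hGc : Continuous G := continuous_iff_continuousAt.2 fun t => (hGd t).continuousAt
  have hPc : Continuous P := continuous_iff_continuousAt.2 fun t => (hPd t).continuousAt
  have hW0 : W 0 = W0 := by
    obtain ⟨h1, h2⟩ := hG 0 le_rfl
    have h3 := (hDsub _ h1 _ h1).2
    have h4 := (hDsub _ h1 _ h1)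
    simp only [sub_self] at h3
    rw [intervalIntegral.integral_same] at h2
    rw [h3] at h2
    simp only [intervalIntegral.integral_same, sub_zero] at h2
    exact (sub_eq_zero.1 h2.symm)
  have hslope : ∀ (F : ℝ → H) (F' : H) (s : ℝ), HasDerivAt F F' s →
      Tendsto (fun h : ℝ => h⁻¹ • (F (s + h) - F s)) (𝓝[>] 0) (𝓝 F') := fun F F' s h =>
    (hasDerivAt_iff_tendsto_slope_zero.1 h).mono_left
      (nhdsWithin_mono _ (fun x hx => ne_of_gt hx))
  have step : ∀ h : ℝ, 0 < h → h⁻¹ • (G (t + h) - G t) =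
      T t (h⁻¹ • (G (0 + h) - G 0)) + ∫ s in (0:ℝ)..t, T (t - s) (h⁻¹ • (P (s + h) - P s)) := by
    intro h hh
    have := sg_duhamel T hT hT0 hadd D A hgen (fun s => G (s + h) - G s)
      (fun s => P (s + h) - P s) (by fun_prop) (by fun_prop) t ht
      (fun s hs => (hDsub _ (hG (s + h) (by linarith [hs.1])).1 _ (hG s hs.1).1).1)
      (fun s hs => by
        have e : A (G (s + h) - G s) + (P (s + h) - P s) = W (s + h) - W s := by
          rw [(hDsub _ (hG (s + h) (by linarith [hs.1])).1 _ (hG s hs.1).1).2,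
            (hG (s + h) (by linarith [hs.1])).2, (hG s hs.1).2]
          abel
        rw [e]
        exact (((hGd (s + h)).comp_add_const s h).sub (hGd s)).hasDerivWithinAt)
    rw [this, smul_add, ContinuousLinearMap.map_smul_of_tower, ← intervalIntegral.integral_smul]
    simp only [ContinuousLinearMap.map_smul_of_tower]
  have l1 := hslope G (W t) t (hGd t)
  have l2 := ((T t).continuous.tendsto _).comp (hslope G (W 0) 0 (hGd 0))
  obtain ⟨C, hC0, hC⟩ := sg_bound T hT 0 t
  obtain ⟨K, hK⟩ := (isCompact_Icc (a := (0:ℝ)) (b := t + 1)).exists_bound_of_continuousOn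
    hV.continuousOn
  have l3 : Tendsto (fun h : ℝ => ∫ s in (0:ℝ)..t, T (t - s) (h⁻¹ • (P (s + h) - P s))) (𝓝[>] 0)
      (𝓝 (∫ s in (0:ℝ)..t, T (t - s) (V s))) := by
    refine intervalIntegral.tendsto_integral_filter_of_dominated_convergence (fun _ => C * K)
      ?_ ?_ ?_ ?_
    · refine Eventually.of_forall fun h => ?_
      exact (sg_cont T hT (by fun_prop) (by fun_prop)).aestronglyMeasurable
    · have hev : ∀ᶠ h : ℝ in 𝓝[>] 0, h < 1 := nhdsWithin_le_nhds (Iio_mem_nhds one_pos)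
      filter_upwards [hev, self_mem_nhdsWithin] with h h1 hpos
      have hpos' : 0 < h := hpos
      refine Eventually.of_forall fun s hs => ?_
      rw [uIoc_of_le ht] at hs
      have hPK : ‖P (s + h) - P s‖ ≤ K * h := by
        have e : P (s + h) - P s = ∫ r in s..(s + h), V r :=
          intervalIntegral.integral_interval_sub_left (hV.intervalIntegrable _ _)
            (hV.intervalIntegrable _ _)
        rw [e]
        have := intervalIntegral.norm_integral_le_of_norm_le_const (a := s) (b := s + h)
          (f := V) (C := K) (fun r hr => by
            rw [uIoc_of_le (by linarith)] at hr
            exact hK r ⟨by linarith [hs.1, hr.1], by linarith [hs.2, hr.2]⟩)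
        simpa [abs_of_pos hpos'] using this
      refine ((T (t - s)).le_opNorm _).trans ?_
      refine mul_le_mul (hC _ ⟨by linarith [hs.2], by linarith [hs.1]⟩) ?_ (norm_nonneg _) hC0
      rw [norm_smul, norm_inv, Real.norm_eq_abs, abs_of_pos hpos']
      rw [inv_mul_le_iff₀ hpos']
      linarith
    · exact intervalIntegrable_const
    · refine Eventually.of_forall fun s _ => ?_
      exact ((T (t - s)).continuous.tendsto _).comp (hslope P (V s) s (hPd s))
  rw [hW0] at l2
  refine tendsto_nhds_unique l1 ((l2.add l3).congr' ?_)
  filter_upwards [self_mem_nhdsWithin] with h hh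
  exact (step h hh).symm

/-- For a continuously differentiable boundary disturbance the weak solution is a mild
solution (Theorem 4 of the paper). -/
theorem statement_17 {H : Type*} [NormedAddCommGroup H] [InnerProductSpace ℂ H] [CompleteSpace H]
    [TopologicalSpace.SeparableSpace H]
    {m : ℕ} (hm : 0 < m)
    (domA : Set H) (A : H → H) (Bop : H → EuclideanSpace ℂ (Fin m))
    (hdomA : ∀ x ∈ domA, ∀ y ∈ domA, ∀ a b : ℂ, a • x + b • y ∈ domA)
    (hAlin : IsLinearOn A domA) (hBoplin : IsLinearOn Bop domA)
    (domAstar : Set H) (Astar : H → H)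
    (hdense : Dense {x : H | x ∈ domA ∧ Bop x = 0})
    (hadjdom : ∀ z : H, z ∈ domAstar ↔ ∃ w : H, ∀ x ∈ domA, Bop x = 0 → ⟪w, x⟫ = ⟪z, A x⟫)
    (hadj : ∀ z ∈ domAstar, ∀ x ∈ domA, Bop x = 0 → ⟪Astar z, x⟫ = ⟪z, A x⟫)
    (B : EuclideanSpace ℂ (Fin m) →L[ℂ] H)
    (hBdom : ∀ v, B v ∈ domA) (hBlift : ∀ v, Bop (B v) = v)
    (hABcont : Continuous fun v => A (B v))
    (S : ℝ → H →L[ℂ] H)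
    (hS : IsC0SemigroupGeneratedBy S {x : H | x ∈ domA ∧ Bop x = 0} A)
    (β : ℝ → ℝ → ℝ) (γ1 γ2 : ℝ → ℝ)
    (hβ : ClassKL β) (hγ1 : ClassK γ1) (hγ2 : ClassK γ2)
    (hexist : ∀ (X0 : H) (d : ℝ → EuclideanSpace ℂ (Fin m)) (U : ℝ → H),
      X0 ∈ domA → ContDiffOn ℝ 2 d (Set.Ici 0) → ContDiffOn ℝ 1 U (Set.Ici 0) → Bop X0 = d 0 →
      ∃ X : ℝ → H, IsClassicalSolution A Bop domA X0 d U X)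
    (hISS : ∀ (X0 : H) (d : ℝ → EuclideanSpace ℂ (Fin m)) (U : ℝ → H) (X : ℝ → H),
      X0 ∈ domA → ContDiffOn ℝ 2 d (Set.Ici 0) → ContDiffOn ℝ 1 U (Set.Ici 0) → Bop X0 = d 0 →
      IsClassicalSolution A Bop domA X0 d U X →
      ∀ t ∈ Set.Ici (0:ℝ),
        ‖X t‖ ≤ β ‖X0‖ t + γ1 (sSup ((fun s => ‖d s‖) '' Set.Icc 0 t))
          + γ2 (sSup ((fun s => ‖U s‖) '' Set.Icc 0 t)))
    (X0 : H) (d : ℝ → EuclideanSpace ℂ (Fin m)) (d' : ℝ → EuclideanSpace ℂ (Fin m))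
    (U : ℝ → H) (X : ℝ → H)
    (hd' : ∀ t ∈ Set.Ici (0:ℝ), HasDerivWithinAt d (d' t) (Set.Ici 0) t)
    (hd'cont : ContinuousOn d' (Set.Ici 0))
    (hU : ContinuousOn U (Set.Ici 0))
    (hX : IsWeakSolution A domAstar Astar B X0 d U X) :
    ∀ t ∈ Set.Ici (0:ℝ),
      X t = S t (X0 - B (d 0)) + B (d t)
        + ∫ τ in (0:ℝ)..t, S (t - τ) (-(B (d' τ)) + A (B (d τ)) + U τ) := by
  obtain ⟨hS0, hSadd, hScont, hSdom, hSgen⟩ := hS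
  obtain ⟨hXc, hXw⟩ := hX
  have hdc : ContinuousOn d (Set.Ici 0) := fun t ht => (hd' t ht).continuousWithinAt
  have hpr : Continuous fun t : ℝ => max t 0 := by fun_prop
  have hprm : ∀ t : ℝ, max t 0 ∈ Set.Ici (0:ℝ) := fun t => Set.mem_Ici.2 (le_max_right _ _)
  have ext : ∀ {E : Type _} [TopologicalSpace E] {f : ℝ → E}, ContinuousOn f (Set.Ici 0) →
      Continuous fun t => f (max t 0) := fun hf => hf.comp_continuous hpr hprm
  have cX := ext hXc
  have cU := ext hU
  have cd : Continuous fun t => d (max t 0) := hdc.comp_continuous hpr hprm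
  have cd' : Continuous fun t => d' (max t 0) := hd'cont.comp_continuous hpr hprm
  have cBd := B.continuous.comp cd
  have cBd' := B.continuous.comp cd'
  have cAB := hABcont.comp cd
  simp only [Function.comp_def] at cBd cBd' cAB
  set D : Set H := {x : H | x ∈ domA ∧ Bop x = 0} with hD
  have hT : ∀ x, Continuous fun t : ℝ => S (max t 0) x := fun x => ext (hScont x)
  have hT0 : S (max 0 0) = ContinuousLinearMap.id ℂ H := by simpa using hS0
  have hTadd : ∀ t, 0 ≤ t → ∀ s, 0 ≤ s →
      S (max (t + s) 0) = (S (max t 0)).comp (S (max s 0)) := by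
    intro t ht s hs
    rw [max_eq_left ht, max_eq_left hs, max_eq_left (add_nonneg ht hs)]
    exact hSadd t ht s hs
  have hcongr : ∀ x : H, (fun h : ℝ => h⁻¹ • (S h x - x)) =ᶠ[nhdsWithin 0 (Set.Ioi 0)]
      (fun h : ℝ => h⁻¹ • (S (max h 0) x - x)) := by
    intro x
    filter_upwards [self_mem_nhdsWithin] with h hh
    rw [max_eq_left (le_of_lt hh)]
  have hTgen : ∀ x ∈ D, Filter.Tendsto (fun h : ℝ => h⁻¹ • (S (max h 0) x - x))
      (nhdsWithin 0 (Set.Ioi 0)) (nhds (A x)) := fun x hx => (hSgen x hx).congr' (hcongr x)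
  have hadjdom' : ∀ z : H, z ∈ domAstar ↔ ∃ w : H, ∀ x ∈ D, ⟪w, x⟫ = ⟪z, A x⟫ := by
    intro z
    rw [hadjdom z]
    exact exists_congr fun w => ⟨fun h x hx => h x hx.1 hx.2, fun h x h1 h2 => h x ⟨h1, h2⟩⟩
  have hadj' : ∀ z ∈ domAstar, ∀ x ∈ D, ⟪Astar z, x⟫ = ⟪z, A x⟫ :=
    fun z hz x hx => hadj z hz x hx.1 hx.2
  have hsm : ∀ z ∈ domAstar, ∀ c : ℂ, c • z ∈ domAstar ∧ Astar (c • z) = c • Astar z := by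
    intro z hz c
    have h1 : ∀ x ∈ D, ⟪c • Astar z, x⟫ = ⟪c • z, A x⟫ := fun x hx => by
      rw [inner_smul_left, inner_smul_left, hadj' z hz x hx]
    have h2 : c • z ∈ domAstar := (hadjdom' _).2 ⟨_, h1⟩
    refine ⟨h2, hdense.eq_of_inner_left (𝕜 := ℂ) ?_⟩
    intro x hx
    rw [hadj' _ h2 x hx, h1 x hx]
  have hDsub : ∀ x ∈ D, ∀ y ∈ D, x - y ∈ D ∧ A (x - y) = A x - A y := by
    intro x hx y hy
    have e : x - y = x + (-1 : ℂ) • y := by rw [neg_one_smul, sub_eq_add_neg]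
    have hy' : (-1 : ℂ) • y ∈ domA := by
      have := hdomA y hy.1 y hy.1 (-1) 0
      simpa using this
    refine ⟨⟨?_, ?_⟩, ?_⟩
    · have := hdomA x hx.1 y hy.1 1 (-1)
      rwa [one_smul, ← e] at this
    · rw [e, hBoplin.1 x hx.1 _ hy', hBoplin.2 _ y hy.1, hx.2, hy.2]; simp
    · rw [e, hAlin.1 x hx.1 _ hy', hAlin.2 _ y hy.1, neg_one_smul, sub_eq_add_neg]
  set W : ℝ → H := fun t => X (max t 0) - B (d (max t 0)) with hW
  set V : ℝ → H := fun t => -(B (d' (max t 0))) + A (B (d (max t 0))) + U (max t 0) with hV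
  have cW : Continuous W := cX.sub cBd
  have cV : Continuous V := (cBd'.neg.add cAB).add cU
  have ftc : ∀ t, 0 ≤ t → ∫ s in (0:ℝ)..t, B (d' (max s 0)) = B (d t) - B (d 0) := by
    intro t ht
    refine intervalIntegral.integral_eq_sub_of_hasDeriv_right_of_le (f := fun s => B (d s)) ht
      (B.continuous.comp_continuousOn (hdc.mono Set.Icc_subset_Ici_self)) ?_
      (cBd'.intervalIntegrable _ _)
    intro s hs
    have h0 : (0:ℝ) ≤ s := hs.1.le
    rw [max_eq_left h0]
    have h1 := (hd' s h0).mono (Set.Ioi_subset_Ici h0)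
    exact (B.restrictScalars ℝ).hasFDerivAt.comp_hasDerivWithinAt s h1
  have weak : ∀ t, 0 ≤ t → ∀ z ∈ domAstar,
      ⟪z, W t - (X0 - B (d 0)) - ∫ s in (0:ℝ)..t, V s⟫ = ⟪Astar z, ∫ s in (0:ℝ)..t, W s⟫ := by
    intro t ht z hz
    have c1 : Continuous fun s => ⟪Astar z, W s⟫ := continuous_const.inner cW
    have c2 : Continuous fun s => ⟪z, A (B (d (max s 0)))⟫ := continuous_const.inner cAB
    have c3 : Continuous fun s => ⟪z, U (max s 0)⟫ := continuous_const.inner cU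
    have cw : Continuous fun s => ⟪z, X (max s 0)⟫ := continuous_const.inner cX
    have c4 : Continuous fun s => ⟪Astar z, X (max s 0)⟫ := continuous_const.inner cX
    have c5 : Continuous fun s => ⟪Astar z, B (d (max s 0))⟫ := continuous_const.inner cBd
    have key := weak_scalar (t + 1) (by linarith) (fun s => ⟪z, X (max s 0)⟫)
      (fun s => ⟪Astar z, W s⟫ + ⟪z, A (B (d (max s 0)))⟫ + ⟪z, U (max s 0)⟫) cw
      ((c1.add c2).add c3) ⟪z, X0⟫ ?_ t ⟨ht, by linarith⟩
    · rw [max_eq_left ht] at key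
      have i1 : ∫ s in (0:ℝ)..t, (⟪Astar z, W s⟫ + ⟪z, A (B (d (max s 0)))⟫ + ⟪z, U (max s 0)⟫)
          = ⟪Astar z, ∫ s in (0:ℝ)..t, W s⟫ + ⟪z, (∫ s in (0:ℝ)..t, V s) + (B (d t) - B (d 0))⟫ := by
        rw [← ftc t ht, ← intervalIntegral.integral_add (cV.intervalIntegrable _ _)
          (cBd'.intervalIntegrable _ _)]
        have cVB : Continuous fun s => V s + B (d' (max s 0)) := cV.add cBd'
        have e1 := ((innerSL ℂ (Astar z)).intervalIntegral_comp_comm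
          (cW.intervalIntegrable (μ := MeasureTheory.volume) 0 t))
        have e2 := ((innerSL ℂ z).intervalIntegral_comp_comm
          (cVB.intervalIntegrable (μ := MeasureTheory.volume) 0 t))
        simp only [innerSL_apply_apply, Pi.add_apply] at e1 e2
        rw [← e1, ← e2, ← intervalIntegral.integral_add (c1.intervalIntegrable _ _)
          ((continuous_const.inner cVB).intervalIntegrable _ _)]
        refine intervalIntegral.integral_congr fun s _ => ?_
        simp only [hV, inner_add_right, inner_neg_right]
        ring
      rw [i1] at key
      simp only [hW, max_eq_left ht, inner_sub_right, inner_add_right] at key ⊢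
      rw [key]
      ring
    · intro φ ψ hφ hψ hφT
      have hpos : 0 < t + 1 := by linarith
      have cφ : Continuous φ := continuous_iff_continuousAt.2 fun s => (hφ s).continuousAt
      have hA : ∀ s, Astar (φ s • z) = φ s • Astar z := fun s => (hsm z hz (φ s)).2
      have h1 := hXw (t + 1) hpos (fun s => φ s • z) (fun s => ψ s • z)
        (fun s _ => (hsm z hz (φ s)).1)
        (fun s _ => ((hφ s).smul_const z).hasDerivWithinAt)
        (hψ.smul continuous_const).continuousOn
        (by simp only [hA]; exact (cφ.smul continuous_const).continuousOn)
        (by simp [hφT])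
      have k1 : Continuous fun s => starRingEnd ℂ (φ s) := Complex.continuous_conj.comp cφ
      have k2 : Continuous fun s => starRingEnd ℂ (ψ s) := Complex.continuous_conj.comp hψ
      have rep : ∀ f g : ℝ → ℂ, (∀ s, 0 ≤ s → f s = g s) →
          ∫ s in (0:ℝ)..(t + 1), f s = ∫ s in (0:ℝ)..(t + 1), g s := fun f g hfg =>
        intervalIntegral.integral_congr fun s hs => by
          rw [Set.uIcc_of_le hpos.le] at hs
          exact hfg s hs.1
      rw [rep _ (fun s => starRingEnd ℂ (φ s) * ⟪Astar z, X (max s 0)⟫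
            + starRingEnd ℂ (ψ s) * ⟪z, X (max s 0)⟫)
            (fun s hs => by
              simp only [hA, max_eq_left hs, inner_add_left, inner_smul_left]),
          rep (fun s => ⟪Astar (φ s • z), B (d s)⟫)
            (fun s => starRingEnd ℂ (φ s) * ⟪Astar z, B (d (max s 0))⟫)
            (fun s hs => by simp only [hA, max_eq_left hs, inner_smul_left]),
          rep (fun s => ⟪φ s • z, A (B (d s))⟫)
            (fun s => starRingEnd ℂ (φ s) * ⟪z, A (B (d (max s 0)))⟫)
            (fun s hs => by simp only [max_eq_left hs, inner_smul_left]),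
          rep (fun s => ⟪φ s • z, U s⟫)
            (fun s => starRingEnd ℂ (φ s) * ⟪z, U (max s 0)⟫)
            (fun s hs => by simp only [max_eq_left hs, inner_smul_left]),
          inner_smul_left] at h1
      have e : ∫ s in (0:ℝ)..(t + 1), (starRingEnd ℂ (ψ s) * ⟪z, X (max s 0)⟫ +
          starRingEnd ℂ (φ s) * (⟪Astar z, W s⟫ + ⟪z, A (B (d (max s 0)))⟫ + ⟪z, U (max s 0)⟫))
          = (∫ s in (0:ℝ)..(t + 1), (starRingEnd ℂ (φ s) * ⟪Astar z, X (max s 0)⟫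
            + starRingEnd ℂ (ψ s) * ⟪z, X (max s 0)⟫))
          - (∫ s in (0:ℝ)..(t + 1), starRingEnd ℂ (φ s) * ⟪Astar z, B (d (max s 0))⟫)
          + (∫ s in (0:ℝ)..(t + 1), starRingEnd ℂ (φ s) * ⟪z, A (B (d (max s 0)))⟫)
          + (∫ s in (0:ℝ)..(t + 1), starRingEnd ℂ (φ s) * ⟪z, U (max s 0)⟫) := by
        rw [← intervalIntegral.integral_sub, ← intervalIntegral.integral_add,
          ← intervalIntegral.integral_add]
        · refine intervalIntegral.integral_congr fun s _ => ?_
          simp only [hW, inner_sub_right]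
          ring
        all_goals
          refine Continuous.intervalIntegrable ?_ _ _
          fun_prop
      rw [e, h1]
      ring
  have hGA : ∀ t, 0 ≤ t → (∫ s in (0:ℝ)..t, W s) ∈ D ∧
      A (∫ s in (0:ℝ)..t, W s) = W t - (X0 - B (d 0)) - ∫ s in (0:ℝ)..t, V s := by
    intro t ht
    have h1 := sg_ball (fun t => S (max t 0)) hT hT0 hTadd D A hdense hTgen domAstar Astar
      hadjdom' hadj' _ _ (weak t ht)
    have h2 := (hSdom (∫ s in (0:ℝ)..t, W s)).2 ⟨_, h1.congr' (hcongr _).symm⟩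
    exact ⟨h2, tendsto_nhds_unique (hTgen _ h2) h1⟩
  intro t ht
  have ht' : (0:ℝ) ≤ t := ht
  have fin := sg_mild (fun t => S (max t 0)) hT hT0 hTadd D A hTgen hDsub W V cW cV
    (X0 - B (d 0)) hGA t ht'
  have e : ∫ s in (0:ℝ)..t, S (max (t - s) 0) (V s)
      = ∫ τ in (0:ℝ)..t, S (t - τ) (-(B (d' τ)) + A (B (d τ)) + U τ) := by
    refine intervalIntegral.integral_congr fun s hs => ?_
    rw [Set.uIcc_of_le ht'] at hs
    have h1 : max (t - s) 0 = t - s := max_eq_left (by linarith [hs.2])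
    have h2 : max s 0 = s := max_eq_left hs.1
    simp only [hV, h1, h2]
  simp only [hW, max_eq_left ht'] at fin
  rw [e] at fin
  rw [sub_eq_iff_eq_add.1 fin]
  abel
end
end
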